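/- arXiv:1406.2422 — 9 statements merged into one kernel-verified Lean document; each statement's English description precedes it below -/
import Mathlib

section
/- Let G : ℝ → ℂ be a smooth function with G(t) ≠ 0 for all t, and suppose the Riemannian metric g = |G|⁻² on ℝ is complete, i.e. ∫_0^∞ dt/|G(t)| = +∞ and ∫_{−∞}^0 dt/|G(t)| = +∞. Then for all x, y ∈ ℝ the spectral distance equals the geodesic distance: sup{f(x) − f(y) : f ∈ C_0^∞(ℝ,ℝ), |G(t)·f'(t)| ≤ 1 for all t ∈ ℝ} = |∫_y^x dt/|G(t)||. -/
open MeasureTheory Filter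

/-- The primitive of a smooth function is smooth. -/
lemma contDiff_intervalIntegral_of_contDiff {w : ℝ → ℝ} (hw : ContDiff ℝ (⊤ : ℕ∞) w) (a : ℝ) :
    ContDiff ℝ (⊤ : ℕ∞) fun t => ∫ s in a..t, w s := by
  have hd : ∀ t, HasDerivAt (fun t => ∫ s in a..t, w s) (w t) t := fun t =>
    hw.continuous.integral_hasStrictDerivAt a t |>.hasDerivAt
  rw [contDiff_infty_iff_deriv]
  exact ⟨fun t => (hd t).differentiableAt, by rwa [funext fun t => (hd t).deriv]⟩

/-- If a nonnegative continuous function has infinite integral over `(0, ∞)`, then its primitive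
tends to infinity. -/
lemma tendsto_intervalIntegral_atTop_of_lintegral_eq_top {w : ℝ → ℝ} (hw : Continuous w)
    (hpos : ∀ t, 0 ≤ w t) (htop : ∫⁻ t in Set.Ioi (0 : ℝ), ENNReal.ofReal (w t) = ⊤) :
    Tendsto (fun t => ∫ s in (0 : ℝ)..t, w s) atTop atTop := by
  have hmono : Monotone fun t => ∫ s in (0 : ℝ)..t, w s :=
    monotone_of_hasDerivAt_nonneg (fun t => (hw.integral_hasStrictDerivAt 0 t).hasDerivAt) hpos
  refine (tendsto_atTop_of_monotone hmono).resolve_right ?_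
  rintro ⟨l, hl⟩
  have hint : IntegrableOn w (Set.Ioi 0) := by
    refine integrableOn_Ioi_of_intervalIntegral_norm_tendsto l 0
      (fun i => (hw.integrableOn_Icc (a := 0) (b := i)).mono_set Set.Ioc_subset_Icc_self)
      tendsto_id ?_
    simpa [abs_of_nonneg (hpos _)] using hl
  exact ((hasFiniteIntegral_iff_ofReal (Eventually.of_forall hpos)).1 hint.2).ne htop

/-- If a nonnegative continuous function has infinite integral over both half-lines, then its
primitive is proper. -/
lemma tendsto_intervalIntegral_cocompact_of_lintegral_eq_top {w : ℝ → ℝ} (hw : Continuous w)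
    (hpos : ∀ t, 0 ≤ w t) (htop : ∫⁻ t in Set.Ioi (0 : ℝ), ENNReal.ofReal (w t) = ⊤)
    (hbot : ∫⁻ t in Set.Iio (0 : ℝ), ENNReal.ofReal (w t) = ⊤) :
    Tendsto (fun t => ∫ s in (0 : ℝ)..t, w s) (cocompact ℝ) (cocompact ℝ) := by
  have hright := tendsto_intervalIntegral_atTop_of_lintegral_eq_top hw hpos htop
  have hneg : ∫⁻ t in Set.Ioi (0 : ℝ), ENNReal.ofReal (w (-t)) = ⊤ := by
    rw [← hbot, ← (Measure.measurePreserving_neg (volume : Measure ℝ)).setLIntegral_comp_preimage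
      measurableSet_Iio (f := fun t => ENNReal.ofReal (w t)) (by fun_prop)]
    simp
  have hleft := tendsto_intervalIntegral_atTop_of_lintegral_eq_top
    (hw.comp continuous_neg) (fun t => hpos (-t)) hneg
  have hleft' : Tendsto (fun t => ∫ s in (0 : ℝ)..t, w s) atBot atBot := by
    have h := tendsto_neg_atTop_atBot.comp (hleft.comp tendsto_neg_atBot_atTop)
    refine h.congr fun t => ?_
    simp [intervalIntegral.integral_comp_neg, intervalIntegral.integral_symm 0 t]
  rw [cocompact_eq_atBot_atTop]
  exact hleft'.sup_sup hright

lemma abs_one_sub_two_mul_mul_exp_neg_le_one {a : ℝ} (ha : 0 ≤ a) :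
    |(1 - 2 * a) * Real.exp (-a)| ≤ 1 := by
  rw [abs_mul, Real.abs_exp, Real.exp_neg, mul_inv_le_iff₀ (Real.exp_pos a), one_mul, abs_le]
  have h := Real.quadratic_le_exp_of_nonneg ha
  constructor <;> nlinarith [sq_nonneg (a - 1)]

lemma hasDerivAt_mul_exp_neg_mul_sq (ε s : ℝ) :
    HasDerivAt (fun s : ℝ => s * Real.exp (-ε * s ^ 2))
      ((1 - 2 * (ε * s ^ 2)) * Real.exp (-(ε * s ^ 2))) s := by
  refine ((hasDerivAt_id' s).mul (((hasDerivAt_pow 2 s).const_mul (-ε)).exp)).congr_deriv ?_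
  rw [neg_mul]
  push_cast
  ring

lemma tendsto_mul_exp_neg_mul_sq_cocompact {ε : ℝ} (hε : 0 < ε) :
    Tendsto (fun s : ℝ => s * Real.exp (-ε * s ^ 2)) (cocompact ℝ) (nhds 0) := by
  rw [tendsto_zero_iff_abs_tendsto_zero]
  refine (tendsto_rpow_abs_mul_exp_neg_mul_sq_cocompact hε 1).congr fun s => ?_
  simp [abs_mul]

/-- Non-flat metric `[x, p] = G(x)` on the real line: if `G : ℝ → ℂ` is a smooth
nowhere-vanishing function and the Riemannian metric `g = |G|⁻²` is complete (the integrals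
of `1/|G|` over `(0, ∞)` and `(−∞, 0)` both diverge), then the spectral distance associated
with the deformed momentum `p(f) = −G·f'` equals the geodesic distance
`d_g(x, y) = |∫_y^x dt/|G(t)||`. The norm condition `‖[p, M_f]‖ ≤ 1` reads
`|G(t)·f'(t)| ≤ 1` for all `t`. -/
theorem spectralDist_eq_geodesicDist_of_nonflat_CCR
    (G : ℝ → ℂ) (hGsmooth : ContDiff ℝ (⊤ : ℕ∞) G) (hG0 : ∀ t, G t ≠ 0)
    (hcomplete₁ : ∫⁻ t in Set.Ioi (0 : ℝ), ENNReal.ofReal ‖G t‖⁻¹ = ⊤)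
    (hcomplete₂ : ∫⁻ t in Set.Iio (0 : ℝ), ENNReal.ofReal ‖G t‖⁻¹ = ⊤)
    (x y : ℝ) :
    (⨆ f : {f : ℝ → ℝ // ContDiff ℝ (⊤ : ℕ∞) f ∧ Tendsto f (cocompact ℝ) (nhds 0) ∧
        ∀ t : ℝ, ‖G t‖ * |deriv f t| ≤ 1},
      ENNReal.ofReal (f.1 x - f.1 y)) =
    ENNReal.ofReal |∫ t in y..x, ‖G t‖⁻¹| := by
  have hnorm : ContDiff ℝ (⊤ : ℕ∞) fun t => ‖G t‖⁻¹ :=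
    (hGsmooth.norm ℝ hG0).inv fun t => norm_ne_zero_iff.2 (hG0 t)
  have hpos : ∀ t, 0 < ‖G t‖ := fun t => norm_pos_iff.2 (hG0 t)
  have hint : ∀ a b : ℝ, IntervalIntegrable (fun t => ‖G t‖⁻¹) volume a b := fun a b =>
    hnorm.continuous.intervalIntegrable a b
  apply le_antisymm
  · refine iSup_le fun ⟨f, hf, _, hf'⟩ => ENNReal.ofReal_le_ofReal ?_
    have hfint : ∫ t in y..x, deriv f t = f x - f y :=
      intervalIntegral.integral_deriv_eq_sub
        (fun t _ => (hf.differentiable (by simp)).differentiableAt)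
        ((hf.continuous_deriv (by simp)).intervalIntegrable y x)
    rw [← hfint]
    refine (Real.le_norm_self _).trans (intervalIntegral.norm_integral_le_abs_of_norm_le
      (Eventually.of_forall fun t => ?_) (hint y x))
    rw [Real.norm_eq_abs, ← one_div, le_div_iff₀' (hpos t)]
    exact hf' t
  · set F : ℝ → ℝ := fun t => ∫ s in (0 : ℝ)..t, ‖G s‖⁻¹
    have hFsmooth : ContDiff ℝ (⊤ : ℕ∞) F := contDiff_intervalIntegral_of_contDiff hnorm 0
    have hFderiv : ∀ t, HasDerivAt F ‖G t‖⁻¹ t := fun t =>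
      (hnorm.continuous.integral_hasStrictDerivAt 0 t).hasDerivAt
    have hFproper : Tendsto F (cocompact ℝ) (cocompact ℝ) :=
      tendsto_intervalIntegral_cocompact_of_lintegral_eq_top hnorm.continuous
        (fun t => (inv_pos.2 (hpos t)).le) hcomplete₁ hcomplete₂
    have hd : ∫ t in y..x, ‖G t‖⁻¹ = F x - F y :=
      (intervalIntegral.integral_interval_sub_left (hint 0 x) (hint 0 y)).symm
    rw [hd]
    set d := F x - F y with hd_def
    obtain ⟨σ, hσ, hσd⟩ : ∃ σ : ℝ, |σ| = 1 ∧ σ * d = |d| := by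
      rcases abs_choice d with h | h
      · exact ⟨1, by simp, by rw [h, one_mul]⟩
      · exact ⟨-1, by simp, by rw [h, neg_one_mul]⟩
    have hlim : Tendsto (fun ε : ℝ => ENNReal.ofReal (|d| * Real.exp (-ε * d ^ 2)))
        (nhdsWithin 0 (Set.Ioi 0)) (nhds (ENNReal.ofReal |d|)) := by
      have hcont : Continuous fun ε : ℝ => ENNReal.ofReal (|d| * Real.exp (-ε * d ^ 2)) :=
        ENNReal.continuous_ofReal.comp (by fun_prop)
      simpa using (hcont.tendsto 0).mono_left nhdsWithin_le_nhds
    refine le_of_tendsto hlim (eventually_mem_nhdsWithin.mono fun ε (hε : 0 < ε) => ?_)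
    let f : ℝ → ℝ := fun t => σ * ((F t - F y) * Real.exp (-ε * (F t - F y) ^ 2))
    have hfsmooth : ContDiff ℝ (⊤ : ℕ∞) f := by fun_prop
    have hftendsto : Tendsto f (cocompact ℝ) (nhds 0) := by
      have hshift : Tendsto (fun t => F t - F y) (cocompact ℝ) (cocompact ℝ) :=
        (Homeomorph.subRight (F y)).isClosedEmbedding.tendsto_cocompact.comp hFproper
      have h := ((tendsto_mul_exp_neg_mul_sq_cocompact hε).comp hshift).const_mul σ
      rwa [mul_zero] at h
    have hfderiv : ∀ t : ℝ, ‖G t‖ * |deriv f t| ≤ 1 := fun t => by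
      have h := ((hasDerivAt_mul_exp_neg_mul_sq ε (F t - F y)).comp t
        ((hFderiv t).sub_const (F y))).const_mul σ
      have hderiv : deriv f t = _ := h.deriv
      rw [hderiv, abs_mul, hσ, one_mul, abs_mul, abs_of_pos (inv_pos.2 (hpos t)), mul_comm,
        mul_assoc, inv_mul_cancel₀ (hpos t).ne', mul_one]
      exact abs_one_sub_two_mul_mul_exp_neg_le_one (by positivity)
    refine le_iSup_of_le ⟨f, hfsmooth, hftendsto, hfderiv⟩ (ENNReal.ofReal_le_ofReal ?_)
    simp only [f, sub_self, zero_mul, mul_zero, sub_zero]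
    rw [← hd_def, ← mul_assoc, hσd]
end

section
/- Fix h > 0 and let x, y ∈ ℝ with x − y ∈ hℤ (i.e. x − y = nh for some integer n). Then the spectral distance associated with the h-derivative satisfies d_{D_h}(x,y) = |x − y|. -/
open MeasureTheory Filter
open scoped ENNReal

noncomputable section

/-- `f` belongs to `C_0^∞(ℝ, ℝ)` (smooth and vanishing at infinity) and satisfies the norm
condition `‖[D_h, M_f]‖ ≤ 1`, i.e. `sup_t |f(t+h) − f(t)| ≤ h` for the `h`-derivative
`D_h f(t) = (f(t+h) − f(t))/h`. -/
def hDerivCondition (h : ℝ) (f : ℝ → ℝ) : Prop :=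
  ContDiff ℝ (⊤ : ℕ∞) f ∧ Tendsto f (cocompact ℝ) (nhds 0) ∧ ∀ t : ℝ, |f (t + h) - f t| ≤ h

/-- The spectral distance associated with the `h`-derivative between two states
(functionals) `φ` and `ψ` on functions on `ℝ`. -/
def hSpecDist (h : ℝ) (φ ψ : (ℝ → ℝ) → ℝ) : ℝ≥0∞ :=
  ⨆ f : {f : ℝ → ℝ // hDerivCondition h f}, ENNReal.ofReal (φ f.1 - ψ f.1)

/-- A function with `h`-increments at most `h` has `n * h`-increments at most `n * h`. -/
lemma abs_sub_le_nat_mul_of_abs_sub_le {h : ℝ} {f : ℝ → ℝ}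
    (hf : ∀ t : ℝ, |f (t + h) - f t| ≤ h) (n : ℕ) (t : ℝ) :
    |f (t + n * h) - f t| ≤ n * h := by
  induction n with
  | zero => simp
  | succ k ih =>
    have hstep := hf (t + k * h)
    have htri := abs_sub_le (f (t + k * h + h)) (f (t + k * h)) (f t)
    rw [show t + ((k + 1 : ℕ) : ℝ) * h = t + k * h + h by push_cast; ring]
    push_cast
    linarith

/-- A function with `h`-increments at most `h` is `1`-Lipschitz on each coset of `hℤ`. -/
lemma sub_le_abs_of_mem_orbit {h : ℝ} {f : ℝ → ℝ} (hh : 0 < h)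
    (hf : ∀ t : ℝ, |f (t + h) - f t| ≤ h) {x y : ℝ} (hxy : ∃ n : ℤ, x - y = n * h) :
    f x - f y ≤ |x - y| := by
  obtain ⟨n, hn⟩ := hxy
  rw [hn, abs_mul, abs_of_pos hh]
  obtain ⟨k, rfl | rfl⟩ := n.eq_nat_or_neg
  · have hk := abs_sub_le_nat_mul_of_abs_sub_le hf k y
    push_cast at hn ⊢
    rw [← hn, add_sub_cancel, hn] at hk
    simpa using (le_abs_self _).trans hk
  · have hk := abs_sub_le_nat_mul_of_abs_sub_le hf k x
    push_cast at hn ⊢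
    rw [show x + k * h = y by linarith, abs_sub_comm] at hk
    simpa using (le_abs_self _).trans hk

/-- The map `s ↦ s / (1 + ε s²)` is `1`-Lipschitz. -/
lemma abs_div_one_add_mul_sq_sub_le {ε : ℝ} (hε : 0 < ε) (a b : ℝ) :
    |a / (1 + ε * a ^ 2) - b / (1 + ε * b ^ 2)| ≤ |a - b| := by
  have ha : 0 < 1 + ε * a ^ 2 := by positivity
  have hb : 0 < 1 + ε * b ^ 2 := by positivity
  have hfactor : a / (1 + ε * a ^ 2) - b / (1 + ε * b ^ 2) =
      (a - b) * ((1 - ε * (a * b)) / ((1 + ε * a ^ 2) * (1 + ε * b ^ 2))) := by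
    field_simp
    ring
  rw [hfactor, abs_mul]
  refine mul_le_of_le_one_right (abs_nonneg _) ?_
  rw [abs_div, abs_of_pos (mul_pos ha hb), div_le_one (mul_pos ha hb), abs_le]
  have hcross : 0 ≤ ε * a ^ 2 * (ε * b ^ 2) := by positivity
  have hadd : 0 ≤ ε * (a + b) ^ 2 := by positivity
  have hsub : 0 ≤ ε * (a - b) ^ 2 := by positivity
  have hsq : 0 ≤ ε * a ^ 2 + ε * b ^ 2 := by positivity
  constructor <;> nlinarith

lemma tendsto_div_one_add_mul_sq_cocompact {ε : ℝ} (hε : 0 < ε) :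
    Tendsto (fun s : ℝ => s / (1 + ε * s ^ 2)) (cocompact ℝ) (nhds 0) := by
  have hbound : Tendsto (fun s : ℝ => ε⁻¹ * ‖s‖⁻¹) (cocompact ℝ) (nhds 0) := by
    simpa using (tendsto_inv_atTop_zero.comp (tendsto_norm_cocompact_atTop (E := ℝ))).const_mul ε⁻¹
  refine squeeze_zero_norm (fun s => ?_) hbound
  rcases eq_or_ne s 0 with rfl | hs
  · simp
  have hs' : 0 < |s| := abs_pos.mpr hs
  have hden : 0 < 1 + ε * s ^ 2 := by positivity
  rw [norm_div, Real.norm_eq_abs, Real.norm_of_nonneg hden.le, ← mul_inv, div_le_iff₀ hden,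
    inv_mul_eq_div, le_div_iff₀ (by positivity)]
  nlinarith [sq_abs s]

/-- Translates of `± s / (1 + ε s²)` are admissible in the definition of the spectral distance. -/
lemma hDerivCondition_mul_div_one_add_mul_sq {h ε σ : ℝ} (hh : 0 < h) (hε : 0 < ε)
    (hσ : |σ| = 1) (y : ℝ) :
    hDerivCondition h (fun t => σ * ((t - y) / (1 + ε * (t - y) ^ 2))) := by
  refine ⟨?_, ?_, fun t => ?_⟩
  · refine contDiff_const.mul (ContDiff.div (by fun_prop) (by fun_prop) fun t => ?_)
    positivity
  · have htrans : Tendsto (fun t : ℝ => t - y) (cocompact ℝ) (cocompact ℝ) :=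
      (Homeomorph.subRight y).isClosedEmbedding.tendsto_cocompact
    simpa using ((tendsto_div_one_add_mul_sq_cocompact hε).comp htrans).const_mul σ
  · rw [← mul_sub, abs_mul, hσ, one_mul]
    refine (abs_div_one_add_mul_sq_sub_le hε _ _).trans_eq ?_
    rw [show t + h - y - (t - y) = h by ring, abs_of_pos hh]

/-- The spectral distance dominates the Euclidean distance between arbitrary points. -/
lemma ofReal_abs_sub_le_hSpecDist {h : ℝ} (hh : 0 < h) (x y : ℝ) :
    ENNReal.ofReal |x - y| ≤ hSpecDist h (fun f => f x) (fun f => f y) := by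
  obtain ⟨σ, hσ, hσxy⟩ : ∃ σ : ℝ, |σ| = 1 ∧ σ * (x - y) = |x - y| := by
    rcases abs_choice (x - y) with habs | habs
    · exact ⟨1, by simp, by rw [habs, one_mul]⟩
    · exact ⟨-1, by simp, by rw [habs, neg_one_mul]⟩
  have hlim : Tendsto (fun ε : ℝ => ENNReal.ofReal (|x - y| / (1 + ε * (x - y) ^ 2)))
      (nhdsWithin 0 (Set.Ioi 0)) (nhds (ENNReal.ofReal |x - y|)) := by
    refine ENNReal.tendsto_ofReal (Tendsto.mono_left ?_ nhdsWithin_le_nhds)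
    have hcont : ContinuousAt (fun ε : ℝ => |x - y| / (1 + ε * (x - y) ^ 2)) 0 :=
      ContinuousAt.div (by fun_prop) (by fun_prop) (by simp)
    simpa [ContinuousAt] using hcont
  refine le_of_tendsto hlim ?_
  filter_upwards [self_mem_nhdsWithin] with ε hε
  refine le_trans (le_of_eq ?_) (le_iSup
    (fun f : {f : ℝ → ℝ // hDerivCondition h f} => ENNReal.ofReal (f.1 x - f.1 y))
    ⟨_, hDerivCondition_mul_div_one_add_mul_sq hh hε hσ y⟩)
  simp [← mul_div_assoc, hσxy]

/-- If `x − y ∈ hℤ` then the spectral distance associated with the `h`-derivative between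
the points `x` and `y` is `|x − y|`. -/
theorem hSpecDist_point_eq_of_mem_orbit {h : ℝ} (hh : 0 < h) {x y : ℝ}
    (hxy : ∃ n : ℤ, x - y = n * h) :
    hSpecDist h (fun f => f x) (fun f => f y) = ENNReal.ofReal |x - y| := by
  refine le_antisymm (iSup_le fun f => ?_) (ofReal_abs_sub_le_hSpecDist hh x y)
  exact ENNReal.ofReal_le_ofReal (sub_le_abs_of_mem_orbit hh f.2.2.2 hxy)

end
end

section
/- Fix h > 0 and let x, y ∈ ℝ with x − y ∉ hℤ. Then the spectral distance associated with the h-derivative is infinite: d_{D_h}(x,y) = +∞; equivalently, for every M > 0 there exists f ∈ C_0^∞(ℝ,ℝ) with sup_t |f(t+h) − f(t)| ≤ h and f(x) − f(y) > M. -/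
open MeasureTheory Filter
open scoped ENNReal

noncomputable section

/-- The bump `A / (1 + ((t - x) / A) ^ 2)` of height `A` centred at `x` is `1`-Lipschitz. -/
lemma abs_bump_sub_le {A h : ℝ} (hA : 0 < A) (hh : 0 < h) (x t : ℝ) :
    |A / (1 + ((t + h - x) / A) ^ 2) - A / (1 + ((t - x) / A) ^ 2)| ≤ h := by
  have key : ∀ a b : ℝ, |(a + b) / ((1 + a ^ 2) * (1 + b ^ 2))| ≤ 1 := by
    intro a b
    rw [abs_div, abs_of_pos (by positivity : 0 < (1 + a ^ 2) * (1 + b ^ 2)),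
      div_le_one (by positivity), abs_le]
    constructor <;>
      nlinarith [sq_nonneg (a + 1), sq_nonneg (b + 1), sq_nonneg (a - 1), sq_nonneg (b - 1),
        sq_nonneg (a * b)]
  have hab : (t + h - x) / A = (t - x) / A + h / A := by ring
  set a := (t + h - x) / A
  set b := (t - x) / A
  have ha : (1 + a ^ 2) ≠ 0 := by positivity
  have hb : (1 + b ^ 2) ≠ 0 := by positivity
  have hAh : A * (a - b) = h := by rw [hab]; field_simp; ring
  have heq : A / (1 + a ^ 2) - A / (1 + b ^ 2)
      = -(h * ((a + b) / ((1 + a ^ 2) * (1 + b ^ 2)))) := by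
    rw [← hAh]; field_simp; ring
  rw [heq, abs_neg, abs_mul, abs_of_pos hh]
  exact mul_le_of_le_one_right hh.le (key a b)

/-- The bump `A / (1 + ((t - x) / A) ^ 2)` vanishes at infinity. -/
lemma tendsto_bump_cocompact {A : ℝ} (hA : 0 < A) (x : ℝ) :
    Tendsto (fun t : ℝ => A / (1 + ((t - x) / A) ^ 2)) (cocompact ℝ) (nhds 0) := by
  apply Tendsto.const_div_atTop
  apply tendsto_atTop_add_const_left
  rw [cocompact_eq_atBot_atTop, tendsto_sup]
  constructor
  · have h1 : Tendsto (fun t : ℝ => (t - x) / A) atBot atBot :=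
      (tendsto_atBot_add_const_right atBot (-x) tendsto_id).atBot_div_const hA
    simpa only [sq] using h1.atBot_mul_atBot₀ h1
  · have h1 : Tendsto (fun t : ℝ => (t - x) / A) atTop atTop :=
      (tendsto_atTop_add_const_right atTop (-x) tendsto_id).atTop_div_const hA
    simpa only [sq] using h1.atTop_mul_atTop₀ h1

/-- The product of the `h`-periodic function `sin² (π (t - y) / h)` with a bump of height `A`
centred at `x` satisfies the norm condition. -/
lemma hDerivCondition_sin_sq_mul_bump {A h : ℝ} (hA : 0 < A) (hh : 0 < h) (x y : ℝ) :
    hDerivCondition h (fun t =>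
      Real.sin (Real.pi * (t - y) / h) ^ 2 * (A / (1 + ((t - x) / A) ^ 2))) := by
  refine ⟨?_, ?_, fun t => ?_⟩
  · refine ContDiff.mul ?_ (contDiff_const.div ?_ fun t => by positivity)
    · exact (Real.contDiff_sin.comp (by fun_prop)).pow 2
    · fun_prop
  · refine squeeze_zero (fun t => by positivity) (fun t => ?_) (tendsto_bump_cocompact hA x)
    exact mul_le_of_le_one_left (by positivity) (Real.sin_sq_le_one _)
  · have hper : Real.sin (Real.pi * (t + h - y) / h) ^ 2
        = Real.sin (Real.pi * (t - y) / h) ^ 2 := by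
      have : Real.pi * (t + h - y) / h = Real.pi * (t - y) / h + Real.pi := by
        field_simp; ring
      rw [this, Real.sin_add_pi, neg_sq]
    simp only [hper]
    rw [← mul_sub, abs_mul, abs_of_nonneg (sq_nonneg _)]
    exact (mul_le_of_le_one_left (abs_nonneg _) (Real.sin_sq_le_one _)).trans
      (abs_bump_sub_le hA hh x t)

/-- If `x − y ∉ hℤ` then the spectral distance associated with the `h`-derivative between
the points `x` and `y` is infinite. -/
theorem hSpecDist_point_eq_top_of_not_mem_orbit {h : ℝ} (hh : 0 < h) {x y : ℝ}
    (hxy : ¬∃ n : ℤ, x - y = n * h) :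
    hSpecDist h (fun f => f x) (fun f => f y) = ⊤ := by
  have hsin : Real.sin (Real.pi * (x - y) / h) ≠ 0 := by
    intro h0
    obtain ⟨n, hn⟩ := Real.sin_eq_zero_iff.mp h0
    refine hxy ⟨n, ?_⟩
    rw [eq_div_iff hh.ne'] at hn
    exact mul_left_cancel₀ Real.pi_ne_zero (by linarith)
  set c := Real.sin (Real.pi * (x - y) / h) ^ 2 with hc_def
  have hc : 0 < c := by positivity
  refine ENNReal.eq_top_of_forall_nnreal_le fun r => ?_
  have hA : 0 < (r + 1 : ℝ) / c := by positivity
  refine le_iSup_of_le ⟨_, hDerivCondition_sin_sq_mul_bump hA hh x y⟩ ?_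
  rw [← ENNReal.ofReal_coe_nnreal]
  refine ENNReal.ofReal_le_ofReal ?_
  simp only [← hc_def, sub_self, mul_zero, zero_div, Real.sin_zero, ne_eq, OfNat.ofNat_ne_zero,
    not_false_eq_true, zero_pow, zero_mul, add_zero, div_one, sub_zero]
  rw [mul_div_cancel₀ _ hc.ne']
  linarith

end
end

section
/- Fix h > 0 and suppose ε = kh for some positive integer k. Then for all x, y ∈ ℝ, the spectral distance associated with the h-derivative between the rectangular states satisfies d_{D_h}(δ_{x,ε}, δ_{y,ε}) = |x − y|; that is, the set of rectangular states of width ε with this distance is isometric to the Euclidean real line. -/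
open MeasureTheory Filter
open scoped ENNReal

noncomputable section

/-- The rectangular state `δ_{x,ε}(f) = (1/ε) ∫_{x−ε/2}^{x+ε/2} f(t) dt`. -/
def rectState (x ε : ℝ) (f : ℝ → ℝ) : ℝ := ε⁻¹ * ∫ t in (x - ε/2)..(x + ε/2), f t

/-- Iterating the bound on increments of step `h`. -/
theorem abs_sub_le_of_step {h : ℝ} {f : ℝ → ℝ} (hf : ∀ t, |f (t + h) - f t| ≤ h) (k : ℕ) (t : ℝ) :
    |f (t + k * h) - f t| ≤ k * h := by
  induction k with
  | zero => simp
  | succ n ih =>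
    have hstep := hf (t + n * h)
    rw [show t + n * h + h = t + (n + 1 : ℕ) * h by push_cast; ring] at hstep
    have htri := abs_sub_le (f (t + (n + 1 : ℕ) * h)) (f (t + n * h)) (f t)
    have hmul : ((n + 1 : ℕ) : ℝ) * h = n * h + h := by push_cast; ring
    linarith

theorem rectState_sub_rectState {f : ℝ → ℝ} (hf : Continuous f) (x y ε : ℝ) :
    rectState x ε f - rectState y ε f =
      ε⁻¹ * ∫ t in x..y, (f (t - ε / 2) - f (t + ε / 2)) := by
  rw [rectState, rectState, ← mul_sub, intervalIntegral.integral_interval_sub_interval_comm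
    (hf.intervalIntegrable _ _) (hf.intervalIntegrable _ _) (hf.intervalIntegrable _ _),
    intervalIntegral.integral_sub, intervalIntegral.integral_comp_sub_right,
    intervalIntegral.integral_comp_add_right]
  · exact Continuous.intervalIntegrable (by fun_prop) _ _
  · exact Continuous.intervalIntegrable (by fun_prop) _ _

theorem rectState_sub_le {f : ℝ → ℝ} (hf : Continuous f) {ε : ℝ} (hε : 0 < ε)
    (hstep : ∀ t, |f (t + ε) - f t| ≤ ε) (x y : ℝ) :
    rectState x ε f - rectState y ε f ≤ |x - y| := by
  have hbound : ‖∫ t in x..y, (f (t - ε / 2) - f (t + ε / 2))‖ ≤ ε * |y - x| := by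
    refine intervalIntegral.norm_integral_le_of_norm_le_const fun t _ => ?_
    rw [Real.norm_eq_abs, abs_sub_comm]
    convert hstep (t - ε / 2) using 4
    ring
  rw [rectState_sub_rectState hf, inv_mul_le_iff₀ hε, abs_sub_comm]
  exact (le_abs_self _).trans hbound

theorem rectState_id {ε : ℝ} (hε : ε ≠ 0) (x : ℝ) : rectState x ε (fun t => t) = x := by
  rw [rectState, integral_id]
  field_simp
  ring

theorem rectState_const_mul (c x ε : ℝ) (f : ℝ → ℝ) :
    rectState x ε (fun t => c * f t) = c * rectState x ε f := by
  rw [rectState, rectState, intervalIntegral.integral_const_mul]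
  ring

/-- Smooth `1`-Lipschitz functions that vanish at infinity for `s ≠ 0` and approximate the
identity as `s → 0`. -/
def dampedId (s t : ℝ) : ℝ := t / (1 + s ^ 2 * t ^ 2)

theorem one_add_sq_mul_sq_pos (s t : ℝ) : 0 < 1 + s ^ 2 * t ^ 2 := by positivity

theorem contDiff_dampedId (s : ℝ) : ContDiff ℝ (⊤ : ℕ∞) (dampedId s) :=
  contDiff_id.div (by fun_prop) fun t => (one_add_sq_mul_sq_pos s t).ne'

theorem continuous_uncurry_dampedId : Continuous (Function.uncurry dampedId) :=
  continuous_snd.div (by fun_prop) fun p => (one_add_sq_mul_sq_pos p.1 p.2).ne'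

theorem abs_dampedId_sub_le (s a b : ℝ) : |dampedId s a - dampedId s b| ≤ |a - b| := by
  have ha := one_add_sq_mul_sq_pos s a
  have hb := one_add_sq_mul_sq_pos s b
  have hdiff : dampedId s a - dampedId s b =
      (a - b) * ((1 - s ^ 2 * (a * b)) / ((1 + s ^ 2 * a ^ 2) * (1 + s ^ 2 * b ^ 2))) := by
    rw [dampedId, dampedId]
    field_simp
    ring
  have hfactor : |(1 - s ^ 2 * (a * b)) / ((1 + s ^ 2 * a ^ 2) * (1 + s ^ 2 * b ^ 2))| ≤ 1 := by
    rw [abs_div, abs_of_pos (mul_pos ha hb), div_le_one (mul_pos ha hb), abs_le]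
    constructor <;>
      nlinarith [sq_nonneg (s * (a + b)), sq_nonneg (s * (a - b)), sq_nonneg (s * a),
        sq_nonneg (s * b), sq_nonneg (s ^ 2 * (a * b))]
  rw [hdiff, abs_mul]
  exact mul_le_of_le_one_right (abs_nonneg _) hfactor

theorem tendsto_dampedId_cocompact {s : ℝ} (hs : s ≠ 0) :
    Tendsto (dampedId s) (cocompact ℝ) (nhds 0) := by
  have hlim : Tendsto (fun t : ℝ => (s ^ 2)⁻¹ * ‖t‖⁻¹) (cocompact ℝ) (nhds 0) := by
    simpa using (tendsto_norm_cocompact_atTop (E := ℝ)).inv_tendsto_atTop.const_mul (s ^ 2)⁻¹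
  refine squeeze_zero_norm (fun t => ?_) hlim
  rcases eq_or_ne t 0 with rfl | ht
  · simp [dampedId]
  · have hnorm : 0 < |t| := abs_pos.mpr ht
    rw [dampedId, norm_div, Real.norm_eq_abs, Real.norm_eq_abs,
      abs_of_pos (one_add_sq_mul_sq_pos s t), ← mul_inv, ← one_div, div_le_div_iff₀
      (one_add_sq_mul_sq_pos s t) (by positivity), ← sq_abs t]
    nlinarith

theorem tendsto_rectState_dampedId {ε : ℝ} (hε : ε ≠ 0) (x : ℝ) :
    Tendsto (fun s => rectState x ε (dampedId s)) (nhds 0) (nhds x) := by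
  have hcont : Continuous fun s => rectState x ε (dampedId s) :=
    (intervalIntegral.continuous_parametric_intervalIntegral_of_continuous'
      continuous_uncurry_dampedId _ _).const_mul _
  have hzero : rectState x ε (dampedId 0) = x := by
    rw [show dampedId 0 = fun t => t by ext t; simp [dampedId], rectState_id hε]
  simpa only [hzero] using hcont.tendsto 0

theorem hDerivCondition_const_mul_dampedId {h c s : ℝ} (hh : 0 < h) (hc : |c| = 1) (hs : s ≠ 0) :
    hDerivCondition h (fun t => c * dampedId s t) := by
  refine ⟨contDiff_const.mul (contDiff_dampedId s), ?_, fun t => ?_⟩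
  · simpa using (tendsto_dampedId_cocompact hs).const_mul c
  · rw [← mul_sub, abs_mul, hc, one_mul]
    simpa [abs_of_pos hh] using abs_dampedId_sub_le s (t + h) t

theorem mul_sub_le_hSpecDist {h ε c : ℝ} (hh : 0 < h) (hε : ε ≠ 0) (hc : |c| = 1) (x y : ℝ) :
    ENNReal.ofReal (c * (x - y)) ≤ hSpecDist h (rectState x ε) (rectState y ε) := by
  have hlim : Tendsto (fun s => ENNReal.ofReal
      (c * (rectState x ε (dampedId s) - rectState y ε (dampedId s))))
      (nhdsWithin 0 {0}ᶜ) (nhds (ENNReal.ofReal (c * (x - y)))) :=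
    (ENNReal.tendsto_ofReal (((tendsto_rectState_dampedId hε x).sub
      (tendsto_rectState_dampedId hε y)).const_mul c)).mono_left nhdsWithin_le_nhds
  refine le_of_tendsto hlim ?_
  filter_upwards [self_mem_nhdsWithin] with s hs
  rw [mul_sub, ← rectState_const_mul, ← rectState_const_mul]
  exact le_iSup (fun f : {f : ℝ → ℝ // hDerivCondition h f} =>
    ENNReal.ofReal (rectState x ε f.1 - rectState y ε f.1))
    ⟨_, hDerivCondition_const_mul_dampedId hh hc hs⟩

/-- If `ε` is a positive integer multiple of `h`, then the spectral distance associated with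
the `h`-derivative between any two rectangular states of width `ε` is the Euclidean distance:
the map `x ↦ δ_{x,ε}` is an isometry onto the Euclidean real line. -/
theorem hSpecDist_rectState_eq_of_eps_mul {h ε : ℝ} (hh : 0 < h) (k : ℕ) (hk : 0 < k)
    (hε : ε = k * h) (x y : ℝ) :
    hSpecDist h (rectState x ε) (rectState y ε) = ENNReal.ofReal |x - y| := by
  have hεpos : 0 < ε := hε ▸ mul_pos (Nat.cast_pos.mpr hk) hh
  refine le_antisymm (iSup_le fun f => ENNReal.ofReal_le_ofReal ?_) ?_
  · refine rectState_sub_le f.2.1.continuous hεpos (fun t => ?_) x y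
    rw [hε]
    exact abs_sub_le_of_step f.2.2.2 k t
  · rcases abs_choice (x - y) with habs | habs
    · simpa [habs] using mul_sub_le_hSpecDist hh hεpos.ne' (c := 1) (by simp) x y
    · simpa [habs] using mul_sub_le_hSpecDist hh hεpos.ne' (c := -1) (by simp) x y

end
end

section
/- Fix h > 0 and ε > 0 such that ε is not a positive-integer multiple of h. If x, y ∈ ℝ satisfy x − y ∉ hℤ, then the spectral distance associated with the h-derivative between the rectangular states is infinite: d_{D_h}(δ_{x,ε}, δ_{y,ε}) = +∞; equivalently, for every M > 0 there exists f ∈ C_0^∞(ℝ,ℝ) with sup_t |f(t+h) − f(t)| ≤ h and δ_{x,ε}(f) − δ_{y,ε}(f) > M. -/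
open MeasureTheory Filter
open scoped ENNReal

noncomputable section

/-- The integral of a shifted sine over a window of length `ε` centred at `x`. -/
lemma integral_sin_mul_sub_window {w : ℝ} (hw : w ≠ 0) (c x ε : ℝ) :
    ∫ t in (x - ε/2)..(x + ε/2), Real.sin (w * (t - c)) =
      2 / w * Real.sin (w * (ε / 2)) * Real.sin (w * (x - c)) := by
  have hderiv : ∀ t ∈ Set.uIcc (x - ε/2) (x + ε/2),
      HasDerivAt (fun t => -Real.cos (w * (t - c)) / w) (Real.sin (w * (t - c))) t := by
    intro t _
    have h1 : HasDerivAt (fun t => w * (t - c)) w t := by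
      simpa using ((hasDerivAt_id t).sub_const c).const_mul w
    have h2 := (h1.cos.neg).div_const w
    rwa [neg_mul, neg_neg, mul_div_cancel_right₀ _ hw] at h2
  rw [intervalIntegral.integral_eq_sub_of_hasDerivAt hderiv
    (Continuous.intervalIntegrable (by fun_prop) _ _)]
  rw [show w * (x + ε/2 - c) = w * (x - c) + w * (ε/2) by ring,
    show w * (x - ε/2 - c) = w * (x - c) - w * (ε/2) by ring, Real.cos_add, Real.cos_sub]
  field_simp
  ring

/-- There are smooth, compactly supported functions that equal one on a prescribed ball and
have arbitrarily small Lipschitz constant. -/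
lemma exists_cutoff_eq_one_of_lipschitz (R : ℝ) {η : ℝ} (hη : 0 < η) :
    ∃ χ : ℝ → ℝ, ContDiff ℝ (⊤ : ℕ∞) χ ∧ HasCompactSupport χ ∧ (∀ t, |t| ≤ R → χ t = 1) ∧
      ∀ s t, |χ s - χ t| ≤ η * |s - t| := by
  let b : ContDiffBump (0 : ℝ) := ⟨1, 2, one_pos, one_lt_two⟩
  have hb : ContDiff ℝ (⊤ : ℕ∞) b := b.contDiff
  obtain ⟨K, hK⟩ := ContDiff.lipschitzWith_of_hasCompactSupport b.hasCompactSupport hb (by simp)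
  obtain ⟨δ, hδ, hδK, hδR⟩ : ∃ δ : ℝ, 0 < δ ∧ K * δ ≤ η ∧ |R| * δ ≤ 1 := by
    have hK0 : (0 : ℝ) ≤ K := K.2
    refine ⟨min (η / (K + 1)) (1 / (|R| + 1)), by positivity, ?_, ?_⟩
    · calc (K : ℝ) * _ ≤ (K + 1) * (η / (K + 1)) := by gcongr <;> simp
        _ = η := by field_simp
    · calc |R| * _ ≤ (|R| + 1) * (1 / (|R| + 1)) := by gcongr <;> simp
        _ = 1 := by field_simp
  refine ⟨fun t => b (δ * t), hb.comp (contDiff_const.mul contDiff_id), ?_, ?_, ?_⟩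
  · exact b.hasCompactSupport.comp_homeomorph (Homeomorph.mulLeft₀ δ hδ.ne')
  · intro t ht
    apply b.one_of_mem_closedBall
    rw [mem_closedBall_zero_iff, Real.norm_eq_abs, abs_mul, abs_of_pos hδ]
    change δ * |t| ≤ 1
    have := ht.trans (le_abs_self R)
    nlinarith
  · intro s t
    have h1 := hK.dist_le_mul (δ * s) (δ * t)
    rw [Real.dist_eq, Real.dist_eq, ← mul_sub, abs_mul, abs_of_pos hδ, ← mul_assoc] at h1
    exact h1.trans (by gcongr)

/-- Multiplying a bounded smooth `h`-periodic function by a slowly varying cutoff produces an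
admissible function that agrees with it on a prescribed ball. -/
lemma exists_hDerivCondition_eq_of_periodic {h : ℝ} (hh : 0 < h) {g : ℝ → ℝ}
    (hg : ContDiff ℝ (⊤ : ℕ∞) g) (hper : Function.Periodic g h) {C : ℝ}
    (hC : ∀ t, |g t| ≤ C) (R : ℝ) :
    ∃ f : ℝ → ℝ, hDerivCondition h f ∧ ∀ t, |t| ≤ R → f t = g t := by
  have hC0 : 0 ≤ C := (abs_nonneg _).trans (hC 0)
  obtain ⟨χ, hχ, hsupp, hone, hlip⟩ :=
    exists_cutoff_eq_one_of_lipschitz R (η := 1 / (C + 1)) (by positivity)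
  refine ⟨fun t => g t * χ t, ⟨hg.mul hχ, ?_, fun t => ?_⟩, fun t ht => by simp [hone t ht]⟩
  · exact (hsupp.mul_left (f := g)).is_zero_at_infty
  · have h1 := hlip (t + h) t
    rw [add_sub_cancel_left, abs_of_pos hh] at h1
    beta_reduce
    rw [hper t, ← mul_sub, abs_mul]
    calc |g t| * |χ (t + h) - χ t| ≤ (C + 1) * (1 / (C + 1) * h) := by
          gcongr
          linarith [hC t]
      _ = h := by field_simp

/-- If some bounded smooth `h`-periodic function has different averages over two windows, then
the rectangular states on these windows are at infinite distance. -/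
lemma hSpecDist_rectState_eq_top_of_periodic {h : ℝ} (hh : 0 < h) {x y ε : ℝ} {g : ℝ → ℝ}
    (hg : ContDiff ℝ (⊤ : ℕ∞) g) (hper : Function.Periodic g h) {C : ℝ}
    (hC : ∀ t, |g t| ≤ C) (hne : rectState x ε g - rectState y ε g ≠ 0) :
    hSpecDist h (rectState x ε) (rectState y ε) = ⊤ := by
  refine ENNReal.eq_top_of_forall_nnreal_le fun M => ?_
  set A : ℝ := M / (rectState x ε g - rectState y ε g) with hA
  obtain ⟨f, hf, hfg⟩ := exists_hDerivCondition_eq_of_periodic hh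
    (contDiff_const.mul hg : ContDiff ℝ (⊤ : ℕ∞) fun t => A * g t)
    (fun t => by simp only [hper t]) (C := |A| * C)
    (fun t => by rw [abs_mul]; gcongr; exact hC t) (|x| + |y| + |ε|)
  have key : ∀ z, |z| ≤ |x| + |y| → rectState z ε f = A * rectState z ε g := by
    intro z hz
    have hcongr : ∫ t in (z - ε/2)..(z + ε/2), f t = ∫ t in (z - ε/2)..(z + ε/2), A * g t := by
      refine intervalIntegral.integral_congr fun t ht => hfg t ?_
      rcases Set.mem_uIcc.1 ht with ht | ht <;>
      · rw [abs_le]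
        constructor <;>
        linarith [neg_abs_le z, le_abs_self z, neg_abs_le ε, le_abs_self ε, abs_nonneg ε]
    rw [rectState, rectState, hcongr, intervalIntegral.integral_const_mul]
    ring
  have hval : rectState x ε f - rectState y ε f = M := by
    rw [key x (by simp), key y (by simp), ← mul_sub, hA, div_mul_cancel₀ _ hne]
  calc (M : ℝ≥0∞) = ENNReal.ofReal (rectState x ε f - rectState y ε f) := by
        rw [hval, ENNReal.ofReal_coe_nnreal]
    _ ≤ _ := le_iSup (fun f : {f : ℝ → ℝ // hDerivCondition h f} =>
        ENNReal.ofReal (rectState x ε f.1 - rectState y ε f.1)) ⟨f, hf⟩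

/-- If `ε` is not a positive integer multiple of `h` and `x − y ∉ hℤ`, then the spectral
distance associated with the `h`-derivative between the rectangular states `δ_{x,ε}` and
`δ_{y,ε}` is infinite. -/
theorem hSpecDist_rectState_eq_top {h ε : ℝ} (hh : 0 < h) (hε : 0 < ε)
    (hεh : ¬∃ k : ℕ, 0 < k ∧ ε = k * h) {x y : ℝ}
    (hxy : ¬∃ n : ℤ, x - y = n * h) :
    hSpecDist h (rectState x ε) (rectState y ε) = ⊤ := by
  have hπ := Real.pi_pos
  set w : ℝ := 2 * Real.pi / h with hw
  have hw0 : w ≠ 0 := by positivity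
  have hsin : ∀ z : ℝ, (¬∃ n : ℤ, z = n * h) → Real.sin (w * (z / 2)) ≠ 0 := by
    intro z hz h0
    obtain ⟨n, hn⟩ := Real.sin_eq_zero_iff.1 h0
    refine hz ⟨n, ?_⟩
    rw [hw] at hn
    field_simp at hn
    linarith
  have hsε : Real.sin (w * (ε / 2)) ≠ 0 := by
    refine hsin ε fun ⟨n, hn⟩ => hεh ?_
    have hn0 : 0 < n := by
      have : (0 : ℝ) < n := pos_of_mul_pos_left (hn ▸ hε) hh.le
      exact_mod_cast this
    lift n to ℕ using hn0.le
    exact ⟨n, by exact_mod_cast hn0, by exact_mod_cast hn⟩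
  have hsxy : Real.sin (w * ((x - y) / 2)) ≠ 0 := hsin _ hxy
  refine hSpecDist_rectState_eq_top_of_periodic hh
    (g := fun t => Real.sin (w * (t - (x + y) / 2))) (C := 1) ?_ ?_
    (fun t => Real.abs_sin_le_one _) ?_
  · exact Real.contDiff_sin.comp (contDiff_const.mul (contDiff_id.sub contDiff_const))
  · intro t
    have : w * (t + h - (x + y) / 2) = w * (t - (x + y) / 2) + 2 * Real.pi := by
      rw [hw]
      field_simp
      ring
    simp only [this, Real.sin_add_two_pi]
  · have hdiff : rectState x ε (fun t => Real.sin (w * (t - (x + y) / 2))) -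
        rectState y ε (fun t => Real.sin (w * (t - (x + y) / 2))) =
        ε⁻¹ * (4 / w * Real.sin (w * (ε / 2)) * Real.sin (w * ((x - y) / 2))) := by
      rw [rectState, rectState, integral_sin_mul_sub_window hw0, integral_sin_mul_sub_window hw0,
        show w * (x - (x + y) / 2) = w * ((x - y) / 2) by ring,
        show w * (y - (x + y) / 2) = -(w * ((x - y) / 2)) by ring, Real.sin_neg]
      ring
    rw [hdiff]
    positivity

end
end

section
/- Fix 0 < q < 1 and f ∈ C_0^∞(ℝ,ℝ), and let D_q f : ℝ → ℝ be the q-derivative of f. Let K be the bounded operator on L²(ℝ) defined by (Kψ)(t) = (D_q f)(t)·ψ(qt) (which is the commutator [−iD_q, M_f] acting on L²(ℝ)). Then ‖K‖ = q^{−1/2}·sup_{t∈ℝ}|D_q f(t)|; moreover, if f is L-Lipschitz (|f(s) − f(t)| ≤ L|s − t| for all s, t), then sup_{t∈ℝ}|D_q f(t)| ≤ L. -/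
open MeasureTheory Filter
open scoped ENNReal

noncomputable section

/-- The `q`-derivative `D_q f(t) = (f(t) − f(qt))/((1−q)t)` for `t ≠ 0`, extended by
continuity at `t = 0` by `D_q f(0) = f'(0)`. -/
def qDeriv (q : ℝ) (f : ℝ → ℝ) : ℝ → ℝ := fun t =>
  if t = 0 then deriv f 0 else (f t - f (q * t)) / ((1 - q) * t)

theorem qDeriv_eq_dslope {q : ℝ} (hq0 : q ≠ 0) (hq1 : q ≠ 1) (f : ℝ → ℝ) :
    qDeriv q f = fun t => (dslope f 0 t - q * dslope f 0 (q * t)) / (1 - q) := by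
  have h1 : 1 - q ≠ 0 := sub_ne_zero.mpr hq1.symm
  ext t
  by_cases ht : t = 0
  · subst ht
    simp only [qDeriv, if_true, mul_zero, dslope_same]
    field_simp
  · rw [qDeriv, if_neg ht, dslope_of_ne _ ht, dslope_of_ne _ (mul_ne_zero hq0 ht),
      slope_def_field, slope_def_field]
    field_simp
    ring

theorem continuous_qDeriv {q : ℝ} (hq0 : q ≠ 0) (hq1 : q ≠ 1) {f : ℝ → ℝ}
    (hf : Differentiable ℝ f) : Continuous (qDeriv q f) := by
  have hd : Continuous (dslope f 0) := by
    rw [← continuousOn_univ, continuousOn_dslope univ_mem]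
    exact ⟨hf.continuous.continuousOn, hf 0⟩
  rw [qDeriv_eq_dslope hq0 hq1]
  fun_prop

theorem abs_qDeriv_le_of_lipschitzWith {q : ℝ} {f : ℝ → ℝ} {L : NNReal}
    (hf : LipschitzWith L f) (t : ℝ) : |qDeriv q f t| ≤ L := by
  by_cases ht : t = 0
  · simpa [qDeriv, ht] using norm_deriv_le_of_lipschitz (x₀ := 0) hf
  · have h := hf.dist_le_mul t (q * t)
    rw [Real.dist_eq, Real.dist_eq, show t - q * t = (1 - q) * t by ring] at h
    rw [qDeriv, if_neg ht, abs_div]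
    exact div_le_of_le_mul₀ (abs_nonneg _) L.2 h

theorem quasiMeasurePreserving_mul_left {q : ℝ} (hq : q ≠ 0) :
    Measure.QuasiMeasurePreserving (q * ·) (volume : Measure ℝ) volume := by
  refine ⟨measurable_const_mul q, ?_⟩
  rw [Real.map_volume_mul_left hq]
  exact Measure.smul_absolutelyContinuous

/-- Dilation by `q` scales the norm of `L²(ℝ)` by `q^{-1/2}`. -/
theorem exists_Lp_ae_eq_comp_mul_left {q : ℝ} (hq : 0 < q) (ψ : Lp ℂ 2 (volume : Measure ℝ)) :
    ∃ φ : Lp ℂ 2 (volume : Measure ℝ), φ =ᵐ[volume] (fun t => ψ (q * t)) ∧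
      ‖φ‖ = (Real.sqrt q)⁻¹ * ‖ψ‖ := by
  have hmap := Real.map_volume_mul_left hq.ne'
  have hψ : AEStronglyMeasurable ψ (Measure.map (q * ·) (volume : Measure ℝ)) :=
    (Lp.stronglyMeasurable ψ).aestronglyMeasurable
  have hnorm : eLpNorm (fun t => ψ (q * t)) 2 volume =
      ENNReal.ofReal (Real.sqrt q)⁻¹ * eLpNorm ψ 2 volume := by
    have h := eLpNorm_map_measure (p := 2) hψ (measurable_const_mul q).aemeasurable
    rw [Function.comp_def] at h
    rw [← h, hmap, eLpNorm_smul_measure_of_ne_top (by simp), smul_eq_mul,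
      abs_of_pos (inv_pos.mpr hq), ENNReal.ofReal_rpow_of_pos (inv_pos.mpr hq)]
    congr 2
    rw [← Real.sqrt_inv, Real.sqrt_eq_rpow]
    simp
  have hmem : MemLp (fun t => ψ (q * t)) 2 volume := by
    refine ⟨hψ.comp_measurable (measurable_const_mul q), ?_⟩
    rw [hnorm]
    exact ENNReal.mul_lt_top ENNReal.ofReal_lt_top (Lp.eLpNorm_lt_top ψ)
  refine ⟨hmem.toLp _, hmem.coeFn_toLp, ?_⟩
  rw [Lp.norm_toLp, hnorm, ENNReal.toReal_mul, ENNReal.toReal_ofReal (by positivity), Lp.norm_def]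

section WeightedDilation

variable {q : ℝ} {g : ℝ → ℝ} {K : Lp ℂ 2 (volume : Measure ℝ) →L[ℂ] Lp ℂ 2 (volume : Measure ℝ)}

theorem norm_weightedDilation_le (hq : 0 < q) {S : ℝ} (hS : ∀ t, |g t| ≤ S)
    (hK : ∀ ψ : Lp ℂ 2 (volume : Measure ℝ),
      (K ψ : ℝ → ℂ) =ᵐ[volume] fun t => (g t : ℂ) * ψ (q * t)) :
    ‖K‖ ≤ (Real.sqrt q)⁻¹ * S := by
  have hS0 : 0 ≤ S := (abs_nonneg _).trans (hS 0)
  refine K.opNorm_le_bound (by positivity) fun ψ => ?_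
  obtain ⟨φ, hφ, hn⟩ := exists_Lp_ae_eq_comp_mul_left hq ψ
  have h : ‖K ψ‖ ≤ S * ‖φ‖ := by
    refine Lp.norm_le_mul_norm_of_ae_le_mul ?_
    filter_upwards [hK ψ, hφ] with t h1 h2
    rw [h1, h2, norm_mul, Complex.norm_real, Real.norm_eq_abs]
    exact mul_le_mul_of_nonneg_right (hS t) (norm_nonneg _)
  calc ‖K ψ‖ ≤ S * ‖φ‖ := h
    _ = (Real.sqrt q)⁻¹ * S * ‖ψ‖ := by rw [hn]; ring

theorem abs_le_norm_weightedDilation (hq : 0 < q) (hg : Continuous g)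
    (hK : ∀ ψ : Lp ℂ 2 (volume : Measure ℝ),
      (K ψ : ℝ → ℂ) =ᵐ[volume] fun t => (g t : ℂ) * ψ (q * t)) (t₀ : ℝ) :
    |g t₀| ≤ Real.sqrt q * ‖K‖ := by
  refine le_of_forall_lt_imp_le_of_dense fun c hc => ?_
  rcases le_or_gt c 0 with hc0 | hc0
  · exact hc0.trans (by positivity)
  obtain ⟨ε, hε, hball⟩ := Metric.eventually_nhds_iff_ball.mp
    (hg.abs.continuousAt.eventually (lt_mem_nhds hc))
  let s : Set ℝ := Metric.ball (q * t₀) (q * ε)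
  have hs : MeasurableSet s := measurableSet_ball
  have hsv : volume s ≠ ∞ := measure_ball_lt_top.ne
  let ψ : Lp ℂ 2 (volume : Measure ℝ) := indicatorConstLp 2 hs hsv 1
  have hψ0 : 0 < ‖ψ‖ := by
    rw [norm_indicatorConstLp (by simp) (by simp), norm_one, one_mul]
    refine Real.rpow_pos_of_pos (ENNReal.toReal_pos ?_ hsv) _
    exact (Metric.measure_ball_pos volume _ (mul_pos hq hε)).ne'
  have hψ : ∀ᵐ t : ℝ, ψ (q * t) = s.indicator (fun _ => 1) (q * t) :=
    (quasiMeasurePreserving_mul_left hq.ne').ae indicatorConstLp_coeFn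
  obtain ⟨φ, hφ, hn⟩ := exists_Lp_ae_eq_comp_mul_left hq ψ
  have h : ‖φ‖ ≤ c⁻¹ * ‖K ψ‖ := by
    refine Lp.norm_le_mul_norm_of_ae_le_mul ?_
    filter_upwards [hK ψ, hφ, hψ] with t h1 h2 h3
    rw [h1, h2, h3, norm_mul, Complex.norm_real, Real.norm_eq_abs]
    by_cases ht : q * t ∈ s
    · have htε : t ∈ Metric.ball t₀ ε := by
        rw [Metric.mem_ball, Real.dist_eq] at ht ⊢
        rw [← mul_sub, abs_mul, abs_of_pos hq] at ht
        exact lt_of_mul_lt_mul_left ht hq.le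
      rw [Set.indicator_of_mem ht, norm_one, mul_one, inv_mul_eq_div, one_le_div hc0]
      exact (hball t htε).le
    · simp [Set.indicator_of_notMem ht]
  have hsq : 0 < Real.sqrt q := Real.sqrt_pos.mpr hq
  rw [hn, inv_mul_eq_div, inv_mul_eq_div, div_le_div_iff₀ hsq hc0] at h
  have h2 : ‖ψ‖ * c ≤ ‖ψ‖ * (Real.sqrt q * ‖K‖) :=
    calc ‖ψ‖ * c ≤ ‖K ψ‖ * Real.sqrt q := h
      _ ≤ ‖K‖ * ‖ψ‖ * Real.sqrt q := by gcongr; exact K.le_opNorm ψ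
      _ = ‖ψ‖ * (Real.sqrt q * ‖K‖) := by ring
  exact le_of_mul_le_mul_left h2 hψ0

end WeightedDilation

/-- For `0 < q < 1` and `f ∈ C_0^∞(ℝ, ℝ)`, the bounded operator `K` on `L²(ℝ)` given by
`(Kψ)(t) = D_q f(t)·ψ(qt)` (i.e. the commutator `[−i D_q, M_f]`) has operator norm
`q^{−1/2}·sup_t |D_q f(t)|`; moreover if `f` is `L`-Lipschitz then `sup_t |D_q f(t)| ≤ L`. -/
theorem norm_qDeriv_commutator {q : ℝ} (hq0 : 0 < q) (hq1 : q < 1)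
    (f : ℝ → ℝ) (hsmooth : ContDiff ℝ (⊤ : ℕ∞) f) (hvanish : Tendsto f (cocompact ℝ) (nhds 0))
    (K : Lp ℂ 2 (volume : Measure ℝ) →L[ℂ] Lp ℂ 2 (volume : Measure ℝ))
    (hK : ∀ ψ : Lp ℂ 2 (volume : Measure ℝ),
      (K ψ : ℝ → ℂ) =ᵐ[volume] fun t => (qDeriv q f t : ℂ) * ψ (q * t)) :
    ‖K‖ = (Real.sqrt q)⁻¹ * (⨆ t : ℝ, |qDeriv q f t|) ∧
    ∀ L : NNReal, LipschitzWith L f → (⨆ t : ℝ, |qDeriv q f t|) ≤ L := by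
  refine ⟨?_, fun L hL => ciSup_le fun t => abs_qDeriv_le_of_lipschitzWith hL t⟩
  have hlow := abs_le_norm_weightedDilation hq0 (continuous_qDeriv hq0.ne' hq1.ne
    (hsmooth.differentiable (by simp))) hK
  refine le_antisymm ?_ ?_
  · exact norm_weightedDilation_le hq0 (le_ciSup ⟨_, Set.forall_mem_range.mpr hlow⟩) hK
  · rw [inv_mul_le_iff₀ (Real.sqrt_pos.mpr hq0)]
    exact ciSup_le hlow

end
end

section
/- Let ε > 0 and let μ be a probability measure on ℝ supported in [−ε, ε]. For any x with 0 < x ≤ π − 2ε, the spectral distance on the circle between the translated state at x and the state at 0 equals x: sup{∫ (f(t+x) − f(t)) dμ(t) : f : ℝ → ℝ smooth, 2π-periodic, |f'(t)| ≤ 1 for all t} = x. -/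
open MeasureTheory Filter
open scoped ENNReal

noncomputable section

/-- A smoothing (for `0 < k < 1`) of the triangle wave `arcsin (sin (t - c))` centred at `c`. -/
def smoothTriangle (c k t : ℝ) : ℝ := Real.arcsin (k * Real.sin (t - c))

namespace smoothTriangle

lemma abs_mul_sin_lt_one {k : ℝ} (hk0 : 0 < k) (hk1 : k < 1) (s : ℝ) : |k * Real.sin s| < 1 := by
  rw [abs_mul, abs_of_pos hk0]
  nlinarith [Real.abs_sin_le_one s, abs_nonneg (Real.sin s)]

lemma contDiff (c : ℝ) {k : ℝ} (hk0 : 0 < k) (hk1 : k < 1) :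
    ContDiff ℝ (⊤ : ℕ∞) (smoothTriangle c k) := by
  rw [contDiff_iff_contDiffAt]
  intro t
  have h := abs_lt.mp (abs_mul_sin_lt_one hk0 hk1 (t - c))
  exact (Real.contDiffAt_arcsin h.1.ne' h.2.ne).comp t
    (contDiff_const.mul (Real.contDiff_sin.comp (contDiff_id.sub contDiff_const))).contDiffAt

lemma periodic (c k : ℝ) : Function.Periodic (smoothTriangle c k) (2 * Real.pi) := by
  intro t
  simp only [smoothTriangle]
  rw [add_sub_right_comm, Real.sin_add_two_pi]

lemma abs_deriv_le_one (c : ℝ) {k : ℝ} (hk0 : 0 < k) (hk1 : k < 1) (t : ℝ) :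
    |deriv (smoothTriangle c k) t| ≤ 1 := by
  have h := abs_lt.mp (abs_mul_sin_lt_one hk0 hk1 (t - c))
  have hd : HasDerivAt (smoothTriangle c k)
      (1 / √(1 - (k * Real.sin (t - c)) ^ 2) * (k * (Real.cos (t - c) * 1))) t :=
    (Real.hasDerivAt_arcsin h.1.ne' h.2.ne).comp t
      ((((hasDerivAt_id t).sub_const c).sin).const_mul k)
  have hpos : 0 < 1 - (k * Real.sin (t - c)) ^ 2 := by nlinarith
  rw [hd.deriv, mul_one, one_div_mul_eq_div, abs_div, abs_of_pos (Real.sqrt_pos.mpr hpos),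
    div_le_one (Real.sqrt_pos.mpr hpos)]
  apply Real.abs_le_sqrt
  have hsum : (k * Real.sin (t - c)) ^ 2 + (k * Real.cos (t - c)) ^ 2 = k ^ 2 := by
    rw [mul_pow, mul_pow, ← mul_add, Real.sin_sq_add_cos_sq, mul_one]
  nlinarith

lemma abs_le (c k t : ℝ) : |smoothTriangle c k t| ≤ Real.pi / 2 :=
  _root_.abs_le.mpr ⟨Real.neg_pi_div_two_le_arcsin _, Real.arcsin_le_pi_div_two _⟩

lemma one_eq {c t : ℝ} (h : |t - c| ≤ Real.pi / 2) : smoothTriangle c 1 t = t - c := by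
  rw [smoothTriangle, one_mul]
  exact Real.arcsin_sin (_root_.abs_le.mp h).1 (_root_.abs_le.mp h).2

lemma continuous_integral_translate_sub (μ : Measure ℝ) [IsFiniteMeasure μ] (c x : ℝ) :
    Continuous fun k => ∫ t, (smoothTriangle c k (t + x) - smoothTriangle c k t) ∂μ := by
  refine continuous_of_dominated (bound := fun _ => Real.pi) (fun k => ?_) (fun k => ?_)
    (integrable_const _) ?_
  · refine Continuous.aestronglyMeasurable ?_
    unfold smoothTriangle
    fun_prop
  · refine .of_forall fun t => ?_
    rw [Real.norm_eq_abs]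
    linarith [abs_sub (smoothTriangle c k (t + x)) (smoothTriangle c k t),
      abs_le c k (t + x), abs_le c k t]
  · refine .of_forall fun t => ?_
    unfold smoothTriangle
    fun_prop

end smoothTriangle

/-- A differentiable function with derivative bounded by `1` moves states by at most the
translation length. -/
lemma integral_translate_sub_le (μ : Measure ℝ) [IsProbabilityMeasure μ] {f : ℝ → ℝ}
    (hf : Differentiable ℝ f) (hf' : ∀ t, |deriv f t| ≤ 1) {x : ℝ} (hx : 0 ≤ x) :
    ∫ t, (f (t + x) - f t) ∂μ ≤ x := by
  have hbound : ∀ t, ‖f (t + x) - f t‖ ≤ x := fun t => by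
    simpa [abs_of_nonneg hx] using
      convex_univ.norm_image_sub_le_of_norm_deriv_le (fun s _ => hf s) (fun s _ => hf' s)
        (Set.mem_univ t) (Set.mem_univ (t + x))
  simpa using (le_abs_self _).trans
    (norm_integral_le_of_norm_le_const (μ := μ) (Eventually.of_forall hbound))

open Real in
/-- Optimal transport on the circle: for a probability measure `μ` supported in `[−ε, ε]`
and `0 < x ≤ π − 2ε`, the spectral (Wasserstein) distance on the circle between the state
translated by `x` and the untranslated state equals `x`. -/
theorem circle_specDist_translated_eq {ε : ℝ} (hε : 0 < ε)
    (μ : Measure ℝ) [IsProbabilityMeasure μ] (hsupp : ∀ᵐ t ∂μ, t ∈ Set.Icc (-ε) ε)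
    {x : ℝ} (hx0 : 0 < x) (hx : x ≤ π - 2 * ε) :
    (⨆ f : {f : ℝ → ℝ // ContDiff ℝ (⊤ : ℕ∞) f ∧ Function.Periodic f (2 * π) ∧
        ∀ t : ℝ, |deriv f t| ≤ 1},
      ENNReal.ofReal (∫ t, (f.1 (t + x) - f.1 t) ∂μ)) = ENNReal.ofReal x := by
  refine le_antisymm (iSup_le fun f => ENNReal.ofReal_le_ofReal ?_) ?_
  · exact integral_translate_sub_le μ (f.2.1.differentiable (by simp)) f.2.2.2 hx0.le
  · have hone : ∫ t, (smoothTriangle (x / 2) 1 (t + x)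
        - smoothTriangle (x / 2) 1 t) ∂μ = x := by
      have hae : ∀ᵐ t ∂μ, smoothTriangle (x / 2) 1 (t + x)
          - smoothTriangle (x / 2) 1 t = x := by
        filter_upwards [hsupp] with t ht
        rw [smoothTriangle.one_eq, smoothTriangle.one_eq]
        · ring
        all_goals
          rw [abs_le]
          constructor <;> linarith [ht.1, ht.2]
      rw [integral_congr_ae hae]
      simp
    have hlim := ((ENNReal.continuous_ofReal.comp
      (smoothTriangle.continuous_integral_translate_sub μ (x / 2) x)).tendsto 1).mono_left
        (nhdsWithin_le_nhds (s := Set.Iio 1))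
    simp only [Function.comp_apply, hone] at hlim
    refine le_of_tendsto hlim ?_
    filter_upwards [Ioo_mem_nhdsLT (zero_lt_one' ℝ)] with k hk
    exact le_iSup_of_le ⟨smoothTriangle (x / 2) k,
      smoothTriangle.contDiff _ hk.1 hk.2, smoothTriangle.periodic _ k,
      smoothTriangle.abs_deriv_le_one _ hk.1 hk.2⟩ le_rfl

end
end

section
/- Let 0 < ε ≤ π/2 and let x satisfy max(0, π − 2ε) < x ≤ π (more precisely: 0 < x, π − 2ε ≤ x ≤ π). Then for the rectangular distribution of width 2ε on the circle, the spectral distance between the translated state at x and the state at 0 is sup{(1/(2ε))∫_{−ε}^{ε} (f(t+x) − f(t)) dt : f : ℝ → ℝ smooth, 2π-periodic, |f'(t)| ≤ 1 for all t} = (−x² + 2πx − (π − 2ε)²)/(4ε); in particular it is strictly smaller than the geodesic distance x when x > π − 2ε. -/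
open MeasureTheory Filter
open scoped ENNReal

noncomputable section

/-- Centring at `x / 2` turns the difference of two window integrals into one window integral of
the odd part of the function about `x / 2`. -/
lemma integral_translate_sub_eq {f : ℝ → ℝ} (hf : Continuous f) (ε x : ℝ) :
    ∫ t in (-ε)..ε, (f (t + x) - f t) =
      ∫ u in (x / 2 - ε)..(x / 2 + ε), (f (x / 2 + u) - f (x / 2 - u)) := by
  rw [intervalIntegral.integral_sub ((by fun_prop : Continuous _).intervalIntegrable _ _)
      ((by fun_prop : Continuous _).intervalIntegrable _ _),
    intervalIntegral.integral_sub ((by fun_prop : Continuous _).intervalIntegrable _ _)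
      ((by fun_prop : Continuous _).intervalIntegrable _ _),
    intervalIntegral.integral_comp_add_right, intervalIntegral.integral_comp_add_left,
    intervalIntegral.integral_comp_sub_left]
  ring_nf

/-- The integral of an odd function over an interval only depends on the absolute value of the
lower endpoint. -/
lemma integral_abs_left_of_odd {h : ℝ → ℝ} (hc : Continuous h) (hodd : ∀ u, h (-u) = -h u)
    (a b : ℝ) : ∫ u in a..b, h u = ∫ u in |a|..b, h u := by
  rcases abs_choice a with ha | ha
  · rw [ha]
  · have h0 : ∫ u in a..(-a), h u = 0 := by
      have h1 := intervalIntegral.integral_comp_neg (a := a) (b := -a) h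
      simp only [hodd, intervalIntegral.integral_neg, neg_neg] at h1
      linarith
    rw [ha, ← intervalIntegral.integral_add_adjacent_intervals (hc.intervalIntegrable a (-a))
      (hc.intervalIntegrable (-a) b), h0, zero_add]

lemma integral_two_mul_id (a b : ℝ) : ∫ u in a..b, 2 * u = b ^ 2 - a ^ 2 := by
  rw [intervalIntegral.integral_const_mul, integral_id]
  ring

lemma integral_two_mul_const_sub (c a b : ℝ) :
    ∫ u in a..b, 2 * (c - u) = 2 * c * (b - a) - (b ^ 2 - a ^ 2) := by
  rw [intervalIntegral.integral_const_mul, intervalIntegral.integral_sub (by simp) (by simp),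
    integral_id, intervalIntegral.integral_const, smul_eq_mul]
  ring

lemma sub_le_abs_sub_of_abs_deriv_le_one {f : ℝ → ℝ} (hf : Differentiable ℝ f)
    (hd : ∀ t, |deriv f t| ≤ 1) (s t : ℝ) : f s - f t ≤ |s - t| := by
  have h := Convex.norm_image_sub_le_of_norm_deriv_le (s := Set.univ) (f := f) (C := 1)
    (fun u _ => hf u) (fun u _ => hd u) convex_univ (Set.mem_univ t) (Set.mem_univ s)
  rw [Real.norm_eq_abs, Real.norm_eq_abs, one_mul] at h
  exact (le_abs_self _).trans h

open Real in
lemma integral_translate_sub_le_s17 {f : ℝ → ℝ} (hf : Differentiable ℝ f)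
    (hp : Function.Periodic f (2 * π)) (hd : ∀ t, |deriv f t| ≤ 1) {ε x : ℝ}
    (hε : ε ≤ π / 2) (hx0 : 0 ≤ x) (hx1 : π - 2 * ε ≤ x) (hx2 : x ≤ π) :
    ∫ t in (-ε)..ε, (f (t + x) - f t) ≤
      (-x ^ 2 + 2 * π * x - (π - 2 * ε) ^ 2) / 2 := by
  have hc := hf.continuous
  have hhc : Continuous fun u => f (x / 2 + u) - f (x / 2 - u) := by fun_prop
  rw [integral_translate_sub_eq hc, integral_abs_left_of_odd hhc (fun u => by
      rw [sub_neg_eq_add, ← sub_eq_add_neg, neg_sub]),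
    ← intervalIntegral.integral_add_adjacent_intervals
      (hhc.intervalIntegrable |x / 2 - ε| (π / 2)) (hhc.intervalIntegrable (π / 2) _)]
  have h1 : ∫ u in |x / 2 - ε|..(π / 2), (f (x / 2 + u) - f (x / 2 - u)) ≤
      ∫ u in |x / 2 - ε|..(π / 2), 2 * u := by
    refine intervalIntegral.integral_mono_on (abs_le.2 ⟨by linarith, by linarith⟩)
      (hhc.intervalIntegrable _ _) ((by fun_prop : Continuous _).intervalIntegrable _ _)
      fun u hu => ?_
    have h0 : 0 ≤ u := (abs_nonneg _).trans hu.1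
    have h := sub_le_abs_sub_of_abs_deriv_le_one hf hd (x / 2 + u) (x / 2 - u)
    rwa [show x / 2 + u - (x / 2 - u) = 2 * u by ring, abs_of_nonneg (by linarith)] at h
  have h2 : ∫ u in (π / 2)..(x / 2 + ε), (f (x / 2 + u) - f (x / 2 - u)) ≤
      ∫ u in (π / 2)..(x / 2 + ε), 2 * (π - u) := by
    refine intervalIntegral.integral_mono_on (by linarith)
      (hhc.intervalIntegrable _ _) ((by fun_prop : Continuous _).intervalIntegrable _ _)
      fun u hu => ?_
    have h0 : u ≤ π := hu.2.trans (by linarith)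
    have h := sub_le_abs_sub_of_abs_deriv_le_one hf hd (x / 2 + u) (x / 2 - u + 2 * π)
    rwa [hp, show x / 2 + u - (x / 2 - u + 2 * π) = -(2 * (π - u)) by ring, abs_neg,
      abs_of_nonneg (by linarith)] at h
  rw [integral_two_mul_id, sq_abs] at h1
  rw [integral_two_mul_const_sub] at h2
  linarith

open Real in
lemma integral_translate_sub_triangle {ε x : ℝ}
    (hε : ε ≤ π / 2) (hx0 : 0 ≤ x) (hx1 : π - 2 * ε ≤ x) (hx2 : x ≤ π) :
    ∫ t in (-ε)..ε, (arcsin (sin (t + x - x / 2)) - arcsin (sin (t - x / 2))) =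
      (-x ^ 2 + 2 * π * x - (π - 2 * ε) ^ 2) / 2 := by
  have hc : Continuous fun u => 2 * arcsin (sin u) := by fun_prop
  rw [integral_translate_sub_eq (f := fun t => arcsin (sin (t - x / 2))) (by fun_prop)]
  have h0 (u : ℝ) : arcsin (sin (x / 2 + u - x / 2)) - arcsin (sin (x / 2 - u - x / 2)) =
      2 * arcsin (sin u) := by
    rw [add_sub_cancel_left, sub_sub_cancel_left, sin_neg, arcsin_neg]
    ring
  simp_rw [h0]
  rw [← intervalIntegral.integral_add_adjacent_intervals
      (hc.intervalIntegrable (x / 2 - ε) (π / 2)) (hc.intervalIntegrable (π / 2) _)]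
  have h1 : ∫ u in (x / 2 - ε)..(π / 2), 2 * arcsin (sin u) =
      ∫ u in (x / 2 - ε)..(π / 2), 2 * u := by
    refine intervalIntegral.integral_congr fun u hu => ?_
    rw [Set.uIcc_of_le (by linarith)] at hu
    simp only [arcsin_sin (by linarith [hu.1] : -(π / 2) ≤ u) hu.2]
  have h2 : ∫ u in (π / 2)..(x / 2 + ε), 2 * arcsin (sin u) =
      ∫ u in (π / 2)..(x / 2 + ε), 2 * (π - u) := by
    refine intervalIntegral.integral_congr fun u hu => ?_
    rw [Set.uIcc_of_le (by linarith)] at hu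
    simp only [← sin_pi_sub u, arcsin_sin (by linarith [hu.2] : -(π / 2) ≤ π - u)
      (by linarith [hu.1])]
  rw [h1, h2, integral_two_mul_id, integral_two_mul_const_sub]
  ring

open Real in
/-- For `0 ≤ k < 1`, a translate of `t ↦ arcsin (k * sin t)` is a smooth periodic function with
slope at most one; these functions approximate the triangle wave as `k → 1`. -/
lemma smooth_triangle_admissible {k : ℝ} (hk0 : 0 ≤ k) (hk1 : k < 1) (c : ℝ) :
    ContDiff ℝ (⊤ : ℕ∞) (fun t => arcsin (k * sin (t - c))) ∧
      Function.Periodic (fun t => arcsin (k * sin (t - c))) (2 * π) ∧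
      ∀ t : ℝ, |deriv (fun t => arcsin (k * sin (t - c))) t| ≤ 1 := by
  have habs (t : ℝ) : |k * sin (t - c)| < 1 := by
    rw [abs_mul, abs_of_nonneg hk0]
    nlinarith [abs_sin_le_one (t - c), abs_nonneg (sin (t - c))]
  have hne (t : ℝ) : k * sin (t - c) ≠ -1 ∧ k * sin (t - c) ≠ 1 :=
    ⟨(abs_lt.1 (habs t)).1.ne', (abs_lt.1 (habs t)).2.ne⟩
  refine ⟨?_, ?_, fun t => ?_⟩
  · rw [contDiff_iff_contDiffAt]
    intro t
    have hin : ContDiff ℝ (⊤ : ℕ∞) fun t => k * sin (t - c) := by fun_prop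
    exact (contDiffAt_arcsin (hne t).1 (hne t).2).comp (𝕜 := ℝ) (g := arcsin) t hin.contDiffAt
  · intro t
    simp only [show t + 2 * π - c = t - c + 2 * π by ring, sin_add_two_pi]
  · have hin : HasDerivAt (fun t => k * sin (t - c)) (k * cos (t - c)) t := by
      simpa using (((hasDerivAt_id t).sub_const c).sin).const_mul k
    have hd := (hasDerivAt_arcsin (hne t).1 (hne t).2).comp t hin
    have hpos : 0 < 1 - (k * sin (t - c)) ^ 2 := by
      have := (sq_lt_one_iff_abs_lt_one _).2 (habs t)
      linarith
    have heq : deriv (fun t => arcsin (k * sin (t - c))) t =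
      1 / √(1 - (k * sin (t - c)) ^ 2) * (k * cos (t - c)) := hd.deriv
    rw [heq, one_div_mul_eq_div, abs_div, abs_of_pos (sqrt_pos.2 hpos),
      div_le_one (sqrt_pos.2 hpos)]
    refine abs_le_sqrt ?_
    have hk : k ^ 2 ≤ 1 := pow_le_one₀ hk0 hk1.le
    rw [mul_pow, mul_pow, cos_sq']
    linarith

open Real in
/-- Optimal transport of rectangular distributions on the circle: for `0 < ε ≤ π/2` and
`0 < x` with `π − 2ε ≤ x ≤ π`, the spectral (Wasserstein) distance on the circle between the
rectangular state of width `2ε` translated by `x` and the untranslated one equals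
`(−x² + 2πx − (π − 2ε)²)/(4ε)`; in particular it is strictly smaller than the geodesic
distance `x` whenever `x > π − 2ε`. -/
theorem circle_specDist_rect_eq {ε : ℝ} (hε0 : 0 < ε) (hε : ε ≤ π / 2)
    {x : ℝ} (hx0 : 0 < x) (hx1 : π - 2 * ε ≤ x) (hx2 : x ≤ π) :
    (⨆ f : {f : ℝ → ℝ // ContDiff ℝ (⊤ : ℕ∞) f ∧ Function.Periodic f (2 * π) ∧
        ∀ t : ℝ, |deriv f t| ≤ 1},
      ENNReal.ofReal ((1 / (2 * ε)) * ∫ t in (-ε)..ε, (f.1 (t + x) - f.1 t))) =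
      ENNReal.ofReal ((-x ^ 2 + 2 * π * x - (π - 2 * ε) ^ 2) / (4 * ε)) ∧
    (π - 2 * ε < x → (-x ^ 2 + 2 * π * x - (π - 2 * ε) ^ 2) / (4 * ε) < x) := by
  have hval (I : ℝ) (hI : I = (-x ^ 2 + 2 * π * x - (π - 2 * ε) ^ 2) / 2) :
      1 / (2 * ε) * I = (-x ^ 2 + 2 * π * x - (π - 2 * ε) ^ 2) / (4 * ε) := by
    rw [hI]
    field_simp
    ring
  refine ⟨le_antisymm (iSup_le fun f => ?_) ?_, fun hx => ?_⟩
  · obtain ⟨f, hf, hp, hd⟩ := f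
    rw [← hval _ rfl]
    refine ENNReal.ofReal_le_ofReal (mul_le_mul_of_nonneg_left ?_ (by positivity))
    exact integral_translate_sub_le_s17 (hf.differentiable (by simp)) hp hd hε hx0.le hx1 hx2
  · have hcont : Continuous fun k : ℝ => ENNReal.ofReal (1 / (2 * ε) *
        ∫ t in (-ε)..ε, (arcsin (k * sin (t + x - x / 2)) - arcsin (k * sin (t - x / 2)))) := by
      refine ENNReal.continuous_ofReal.comp (continuous_const.mul ?_)
      exact intervalIntegral.continuous_parametric_intervalIntegral_of_continuous'
        (by fun_prop) _ _
    have hlim := (hcont.tendsto 1).mono_left (nhdsWithin_le_nhds (s := Set.Iio 1))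
    simp only [one_mul] at hlim
    rw [hval _ (integral_translate_sub_triangle hε hx0.le hx1 hx2)] at hlim
    refine le_of_tendsto hlim ?_
    filter_upwards [Ioo_mem_nhdsLT (zero_lt_one' ℝ)] with k hk
    exact le_iSup_of_le ⟨_, smooth_triangle_admissible hk.1.le hk.2 (x / 2)⟩ le_rfl
  · rw [div_lt_iff₀ (by positivity)]
    nlinarith [sq_pos_of_pos (sub_pos.2 hx)]

end
end

section
/- Let μ be a compactly supported probability measure on ℝ. For any x, y ∈ ℝ, the spectral distance (for the usual derivative on the real line) between the translated states Φ_x(f) = ∫ f(t+x) dμ(t) and Φ_y(f) = ∫ f(t+y) dμ(t) equals the amplitude of translation: sup{Φ_x(f) − Φ_y(f) : f ∈ C_0^∞(ℝ,ℝ), |f'(t)| ≤ 1 for all t} = |x − y|. -/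
open MeasureTheory Filter
open scoped ENNReal

noncomputable section

/-- A continuous function vanishing at infinity has integrable translates with respect to any
finite measure. -/
lemma integrable_comp_add_right_of_tendsto_cocompact {μ : Measure ℝ} [IsFiniteMeasure μ]
    {f : ℝ → ℝ} (hf : Continuous f) (h0 : Tendsto f (cocompact ℝ) (nhds 0)) (x : ℝ) :
    Integrable (fun t => f (t + x)) μ := by
  let g : ZeroAtInftyContinuousMap ℝ ℝ := ⟨⟨f, hf⟩, h0⟩
  exact Integrable.of_bound (by fun_prop) ‖g.toBCF‖
    (Eventually.of_forall fun t => g.toBCF.norm_coe_le_norm (t + x))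

lemma abs_sub_le_of_abs_deriv_le_one {f : ℝ → ℝ} (hf : Differentiable ℝ f)
    (hd : ∀ t, |deriv f t| ≤ 1) (a b : ℝ) : |f a - f b| ≤ |a - b| := by
  have h := convex_univ.norm_image_sub_le_of_norm_deriv_le (𝕜 := ℝ) (f := f) (C := 1)
    (fun t _ => hf t) (fun t _ => hd t) (Set.mem_univ b) (Set.mem_univ a)
  simpa using h

/-- The function `t ↦ s * t / (1 + ε * t ^ 2)`: for small `ε` a smooth approximation, vanishing
at infinity, of the linear function of slope `s`. -/
def dampedLinear (s ε t : ℝ) : ℝ := s * t / (1 + ε * t ^ 2)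

lemma contDiff_dampedLinear (s : ℝ) {ε : ℝ} (hε : 0 < ε) :
    ContDiff ℝ (⊤ : ℕ∞) (dampedLinear s ε) :=
  ContDiff.div (by fun_prop) (by fun_prop) fun t => by positivity

lemma tendsto_dampedLinear_cocompact (s : ℝ) {ε : ℝ} (hε : 0 < ε) :
    Tendsto (dampedLinear s ε) (cocompact ℝ) (nhds 0) := by
  have h : Tendsto (fun t : ℝ => |s| * ε⁻¹ * ‖t‖⁻¹) (cocompact ℝ) (nhds 0) := by
    simpa using (tendsto_norm_cocompact_atTop (E := ℝ)).inv_tendsto_atTop.const_mul (|s| * ε⁻¹)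
  refine squeeze_zero_norm (fun t => ?_) h
  rcases eq_or_ne t 0 with rfl | ht
  · simp [dampedLinear]
  have ht' : 0 < |t| := abs_pos.2 ht
  have hpos : 0 < 1 + ε * t ^ 2 := by positivity
  rw [dampedLinear, Real.norm_eq_abs, Real.norm_eq_abs, abs_div, abs_mul, abs_of_pos hpos,
    mul_assoc, mul_div_assoc, ← mul_inv]
  refine mul_le_mul_of_nonneg_left ?_ (abs_nonneg s)
  rw [div_le_iff₀ hpos, ← sq_abs t, inv_mul_eq_div, le_div_iff₀ (by positivity)]
  nlinarith

lemma hasDerivAt_dampedLinear (s : ℝ) {ε : ℝ} (hε : 0 < ε) (t : ℝ) :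
    HasDerivAt (dampedLinear s ε) (s * (1 - ε * t ^ 2) / (1 + ε * t ^ 2) ^ 2) t := by
  have hnum : HasDerivAt (fun t : ℝ => s * t) s t := by
    simpa using (hasDerivAt_id t).const_mul s
  have hden : HasDerivAt (fun t : ℝ => 1 + ε * t ^ 2) (ε * (2 * t)) t := by
    simpa using ((hasDerivAt_pow 2 t).const_mul ε).const_add 1
  exact (hnum.div hden (by positivity)).congr_deriv (by ring)

lemma abs_deriv_dampedLinear_le {s ε : ℝ} (hs : |s| ≤ 1) (hε : 0 < ε) (t : ℝ) :
    |deriv (dampedLinear s ε) t| ≤ 1 := by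
  have hu : 0 ≤ ε * t ^ 2 := by positivity
  rw [(hasDerivAt_dampedLinear s hε t).deriv, abs_div, abs_mul,
    abs_of_pos (a := (1 + ε * t ^ 2) ^ 2) (by positivity), div_le_one (by positivity)]
  have h : |1 - ε * t ^ 2| ≤ (1 + ε * t ^ 2) ^ 2 := abs_le.2 ⟨by nlinarith, by nlinarith⟩
  calc |s| * |1 - ε * t ^ 2| ≤ 1 * |1 - ε * t ^ 2| := by gcongr
    _ ≤ (1 + ε * t ^ 2) ^ 2 := by rwa [one_mul]

lemma tendsto_dampedLinear (s t : ℝ) {ε : ℕ → ℝ} (hε : Tendsto ε atTop (nhds 0)) :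
    Tendsto (fun n => dampedLinear s (ε n) t) atTop (nhds (s * t)) := by
  have h : Tendsto (fun n => 1 + ε n * t ^ 2) atTop (nhds 1) := by
    simpa using (hε.mul_const (t ^ 2)).const_add 1
  have hdiv := (tendsto_const_nhds (x := s * t)).div h one_ne_zero
  rwa [div_one] at hdiv

/-- For a compactly supported probability measure `μ` on `ℝ`, the spectral distance (for the
usual Dirac operator on the real line) between the translates of `μ` by `x` and by `y`
equals the amplitude of translation `|x − y|`. -/
theorem specDist_translated_states_eq {μ : Measure ℝ} [IsProbabilityMeasure μ]
    (hsupp : ∃ K : Set ℝ, IsCompact K ∧ μ Kᶜ = 0) (x y : ℝ) :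
    (⨆ f : {f : ℝ → ℝ // ContDiff ℝ (⊤ : ℕ∞) f ∧ Tendsto f (cocompact ℝ) (nhds 0) ∧
        ∀ t : ℝ, |deriv f t| ≤ 1},
      ENNReal.ofReal ((∫ t, f.1 (t + x) ∂μ) - ∫ t, f.1 (t + y) ∂μ)) =
      ENNReal.ofReal |x - y| := by
  have hlip : ∀ f : ℝ → ℝ, ContDiff ℝ (⊤ : ℕ∞) f → (∀ t, |deriv f t| ≤ 1) →
      ∀ t, |f (t + x) - f (t + y)| ≤ |x - y| := fun f hf hd t => by
    simpa using abs_sub_le_of_abs_deriv_le_one (hf.differentiable (by simp)) hd (t + x) (t + y)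
  apply le_antisymm
  · refine iSup_le fun ⟨f, hf, h0, hd⟩ => ENNReal.ofReal_le_ofReal ?_
    have hx := integrable_comp_add_right_of_tendsto_cocompact (μ := μ) hf.continuous h0 x
    have hy := integrable_comp_add_right_of_tendsto_cocompact (μ := μ) hf.continuous h0 y
    rw [← integral_sub hx hy]
    calc ∫ t, (f (t + x) - f (t + y)) ∂μ ≤ ∫ _, |x - y| ∂μ :=
          integral_mono (hx.sub hy) (integrable_const _)
            fun t => (le_abs_self _).trans (hlip f hf hd t)
      _ = |x - y| := by simp
  · obtain ⟨s, hs, hsxy⟩ : ∃ s : ℝ, |s| ≤ 1 ∧ s * (x - y) = |x - y| := by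
      rcases le_total 0 (x - y) with h | h
      · exact ⟨1, by simp, by rw [abs_of_nonneg h, one_mul]⟩
      · exact ⟨-1, by simp, by rw [abs_of_nonpos h, neg_one_mul]⟩
    let ε : ℕ → ℝ := fun n => 1 / ((n : ℝ) + 1)
    have hε : ∀ n, 0 < ε n := fun n => Nat.one_div_pos_of_nat
    have hε0 : Tendsto ε atTop (nhds 0) := tendsto_one_div_add_atTop_nhds_zero_nat
    have hcont n : Continuous (dampedLinear s (ε n)) := (contDiff_dampedLinear s (hε n)).continuous
    have hlim : Tendsto (fun n => (∫ t, dampedLinear s (ε n) (t + x) ∂μ) -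
        ∫ t, dampedLinear s (ε n) (t + y) ∂μ) atTop (nhds |x - y|) := by
      have h : Tendsto (fun n => ∫ t, (dampedLinear s (ε n) (t + x) -
          dampedLinear s (ε n) (t + y)) ∂μ) atTop (nhds (∫ _, |x - y| ∂μ)) := by
        refine tendsto_integral_of_dominated_convergence (fun _ => |x - y|)
          (fun n => ?_) (integrable_const _) (fun n => ?_) ?_
        · have := hcont n
          exact Continuous.aestronglyMeasurable (by fun_prop)
        · exact Eventually.of_forall (hlip _ (contDiff_dampedLinear s (hε n))
            (abs_deriv_dampedLinear_le hs (hε n)))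
        · refine Eventually.of_forall fun t => ?_
          convert (tendsto_dampedLinear s (t + x) hε0).sub (tendsto_dampedLinear s (t + y) hε0)
            using 2
          rw [← hsxy]
          ring
      simp only [integral_const, probReal_univ, one_smul] at h
      refine h.congr fun n => integral_sub ?_ ?_ <;>
        exact integrable_comp_add_right_of_tendsto_cocompact (hcont n)
          (tendsto_dampedLinear_cocompact s (hε n)) _
    refine le_of_tendsto' (ENNReal.tendsto_ofReal hlim) fun n => ?_
    exact le_iSup_of_le ⟨dampedLinear s (ε n), contDiff_dampedLinear s (hε n),
      tendsto_dampedLinear_cocompact s (hε n), abs_deriv_dampedLinear_le hs (hε n)⟩ le_rfl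

end
end
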